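/- Let d ≥ 3 and 0 ≤ m ≤ d. Then the Green's function of the simple random walk on U_m = ℕ₀^m × ℤ^{d−m} at the origin is G_m(0, 0) = (1/(2d)) ∫_0^∞ e^{−x} ( I₁(x/d) + I₀(x/d) )^m · I₀(x/d)^{d−m} dx, where I₀ and I₁ are the modified Bessel functions of the first kind of orders 0 and 1. -/

import Mathlib

open scoped ENNReal
open Filter

noncomputable section

variable {V : Type*}

/-- Total conductance (weight) `π(x) = Σ_y c(x,y)` at a vertex `x`. -/
def piW (c : V → V → ℝ≥0∞) (x : V) : ℝ≥0∞ := ∑' y, c x y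

/-- One-step transition probability `c(x,y)/π(x)` of the random walk with conductances `c`. -/
def step (c : V → V → ℝ≥0∞) (x y : V) : ℝ≥0∞ := c x y / piW c x

/-- `n`-step transition probability of the random walk with conductances `c`. -/
def stepN [DecidableEq V] (c : V → V → ℝ≥0∞) : ℕ → V → V → ℝ≥0∞
  | 0, x, y => if x = y then 1 else 0
  | n + 1, x, y => ∑' z, stepN c n x z * step c z y

/-- Green's function `G(x,y) = π(y)⁻¹ Σ_n p_n(x,y)` of the walk with conductances `c`. -/
def green [DecidableEq V] (c : V → V → ℝ≥0∞) (x y : V) : ℝ≥0∞ :=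
  (piW c y)⁻¹ * ∑' n, stepN c n x y

/-- Nearest-neighbour adjacency on `ℤ^d`. -/
def latAdj {d : ℕ} (x y : Fin d → ℤ) : Prop := (∑ i, (x i - y i).natAbs) = 1

instance {d : ℕ} (x y : Fin d → ℤ) : Decidable (latAdj x y) := by
  unfold latAdj; infer_instance

/-- Unit conductances on `ℤ^d`. -/
def cZ (d : ℕ) (x y : Fin d → ℤ) : ℝ≥0∞ := if latAdj x y then 1 else 0

/-- Green's function of the simple random walk on `ℤ^d`. -/
def g (d : ℕ) : (Fin d → ℤ) → (Fin d → ℤ) → ℝ≥0∞ := green (cZ d)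

/-- Membership in `U_m = ℕ₀^m × ℤ^{d-m}`: the first `m` coordinates are nonnegative. -/
def memU (m : ℕ) {d : ℕ} (x : Fin d → ℤ) : Prop := ∀ i : Fin d, (i : ℕ) < m → 0 ≤ x i

instance (m : ℕ) {d : ℕ} (x : Fin d → ℤ) : Decidable (memU m x) := by
  unfold memU; infer_instance

/-- Unit conductances on the subgraph `U_m` of `ℤ^d`. -/
def cU (d m : ℕ) (x y : Fin d → ℤ) : ℝ≥0∞ :=
  if memU m x ∧ memU m y ∧ latAdj x y then 1 else 0

/-- Green's function `G_m` of the simple random walk on `U_m = ℕ₀^m × ℤ^{d-m}`. -/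
def Gm (d m : ℕ) : (Fin d → ℤ) → (Fin d → ℤ) → ℝ≥0∞ := green (cU d m)

/-- Reflection in the first coordinate: `ȳ = (-y₁, y₂, …, y_d)`. -/
def reflFirst {d : ℕ} (y : Fin d → ℤ) : Fin d → ℤ := fun i => if (i : ℕ) = 0 then -y i else y i

/-- The first standard basis vector of `ℤ^d`. -/
def e1 (d : ℕ) : Fin d → ℤ := fun i => if (i : ℕ) = 0 then 1 else 0


/-- The modified Bessel function of the first kind of integer order `k ≥ 0`:
`I_k(t) = (1/π) ∫_0^π e^{t cos θ} cos(kθ) dθ`. -/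
def besselI (k : ℕ) (t : ℝ) : ℝ :=
  (1 / Real.pi) * ∫ θ in (0 : ℝ)..Real.pi, Real.exp (t * Real.cos θ) * Real.cos (k * θ)

/-- The neighbour of `y` in `ℤ^d` in direction `± e_i`, the sign being given by a Boolean. -/
def latNbr {d : ℕ} (y : Fin d → ℤ) (p : Fin d × Bool) : Fin d → ℤ :=
  Function.update y p.1 (y p.1 + if p.2 then 1 else -1)

lemma latNbr_injective {d : ℕ} (y : Fin d → ℤ) : Function.Injective (latNbr y) := by
  rintro ⟨i, b⟩ ⟨j, c⟩ h
  have hi := congrFun h i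
  by_cases hij : i = j
  · subst hij
    cases b <;> cases c <;> simp [latNbr] at hi ⊢
  · cases b <;> simp [latNbr, hij] at hi

lemma latAdj_comm {d : ℕ} (x y : Fin d → ℤ) : latAdj x y ↔ latAdj y x := by
  unfold latAdj
  have : ∀ i, (x i - y i).natAbs = (y i - x i).natAbs := fun i => by omega
  simp_rw [this]

lemma latAdj_latNbr {d : ℕ} (y : Fin d → ℤ) (p : Fin d × Bool) : latAdj (latNbr y p) y := by
  unfold latAdj
  rw [Finset.sum_eq_single p.1]
  · rcases p with ⟨i, b⟩
    cases b <;> simp [latNbr]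
  · intro j _ hj
    simp [latNbr, hj]
  · simp

lemma exists_latNbr_of_latAdj {d : ℕ} {z y : Fin d → ℤ} (h : latAdj z y) :
    ∃ p, latNbr y p = z := by
  unfold latAdj at h
  obtain ⟨i, hi⟩ : ∃ i, (z i - y i).natAbs ≠ 0 := by
    by_contra! hc
    simp [hc] at h
  have hsplit := Finset.add_sum_erase Finset.univ (fun i => (z i - y i).natAbs)
    (Finset.mem_univ i)
  simp only [h] at hsplit
  have hz : ∑ j ∈ Finset.univ.erase i, (z j - y j).natAbs = 0 := by omega
  have hother : ∀ j, j ≠ i → z j = y j := by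
    intro j hj
    have := Finset.sum_eq_zero_iff.1 hz j (by simp [hj])
    omega
  refine ⟨(i, decide (z i - y i = 1)), ?_⟩
  funext j
  by_cases hj : j = i
  · subst hj
    simp only [latNbr, Function.update_self, decide_eq_true_eq]
    split_ifs <;> omega
  · simp [latNbr, hj, hother j hj]

lemma tsum_mul_cU {d m : ℕ} (f : (Fin d → ℤ) → ℝ≥0∞) {y : Fin d → ℤ} (hy : memU m y) :
    ∑' z, f z * cU d m z y = ∑ p, if memU m (latNbr y p) then f (latNbr y p) else 0 := by
  rw [← (latNbr_injective y).tsum_eq (f := fun z => f z * cU d m z y), tsum_fintype]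
  · refine Finset.sum_congr rfl fun p _ => ?_
    simp [cU, hy, latAdj_latNbr]
  · intro z hz
    by_contra hc
    apply hz
    have : ¬ latAdj z y := fun h => hc (exists_latNbr_of_latAdj h)
    simp [cU, this]

lemma cU_comm {d m : ℕ} (x y : Fin d → ℤ) : cU d m x y = cU d m y x := by
  simp only [cU, latAdj_comm x y, and_left_comm]

lemma piW_cU {d m : ℕ} {y : Fin d → ℤ} (hy : memU m y) :
    piW (cU d m) y = ∑ p, if memU m (latNbr y p) then 1 else 0 := by
  rw [piW, ← tsum_mul_cU (fun _ => 1) hy]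
  simp [cU_comm y]

lemma piW_cU_ne_zero {d m : ℕ} (hd : 0 < d) {y : Fin d → ℤ} (hy : memU m y) :
    piW (cU d m) y ≠ 0 := by
  rw [piW_cU hy]
  intro h
  have := Finset.sum_eq_zero_iff.1 h (⟨0, hd⟩, true) (Finset.mem_univ _)
  have hU : memU m (latNbr y (⟨0, hd⟩, true)) := by
    intro i hi
    have := hy i hi
    by_cases h0 : i = ⟨0, hd⟩
    · subst h0
      simp only [latNbr, Function.update_self, if_true]
      omega
    · simpa [latNbr, h0] using this
  simp [hU] at this

lemma piW_cU_ne_top {d m : ℕ} {y : Fin d → ℤ} (hy : memU m y) : piW (cU d m) y ≠ ∞ := by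
  rw [piW_cU hy]
  refine ENNReal.sum_ne_top.2 fun p _ => ?_
  split_ifs <;> simp

lemma piW_mul_add {d m : ℕ} {y : Fin d → ℤ} (hy : memU m y) (a : ℝ≥0∞) :
    piW (cU d m) y * a + ∑ p, (if memU m (latNbr y p) then 0 else a) = 2 * d * a := by
  rw [piW_cU hy, Finset.sum_mul, ← Finset.sum_add_distrib]
  rw [Finset.sum_congr rfl (g := fun _ => a)]
  · simp [mul_comm]
  · intro p _
    split_ifs <;> simp

/-- Number of `n`-step paths from `0` to `y` in `U_m`, once loops have been added at the boundary
so that every vertex has degree `2d`. -/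
def loopPaths (d m : ℕ) : ℕ → (Fin d → ℤ) → ℝ≥0∞
  | 0, y => if 0 = y then 1 else 0
  | n + 1, y => ∑ p, if memU m (latNbr y p) then loopPaths d m n (latNbr y p)
      else loopPaths d m n y

/-- Green's function from `0` of the walk on `U_m` with loops added at the boundary. -/
def loopGreen (d m : ℕ) (y : Fin d → ℤ) : ℝ≥0∞ :=
  ∑' n, loopPaths d m n y * (2 * d : ℝ≥0∞)⁻¹ ^ (n + 1)

lemma two_mul_mul_inv_pow {d : ℕ} (hd : 0 < d) (a : ℝ≥0∞) (n : ℕ) :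
    (2 * d : ℝ≥0∞) * (a * (2 * d : ℝ≥0∞)⁻¹ ^ (n + 1)) = a * (2 * d : ℝ≥0∞)⁻¹ ^ n := by
  have h0 : (2 * d : ℝ≥0∞) ≠ 0 := by simp [hd.ne']
  have ht : (2 * d : ℝ≥0∞) ≠ ∞ := by finiteness
  rw [pow_succ', mul_left_comm, ← mul_assoc (2 * d : ℝ≥0∞), ENNReal.mul_inv_cancel h0 ht, one_mul]

lemma two_mul_loopGreen {d m : ℕ} (hd : 0 < d) (y : Fin d → ℤ) :
    2 * d * loopGreen d m y = (if 0 = y then 1 else 0) +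
      ∑ p, if memU m (latNbr y p) then loopGreen d m (latNbr y p) else loopGreen d m y := by
  rw [loopGreen, ← ENNReal.tsum_mul_left]
  simp_rw [two_mul_mul_inv_pow hd]
  rw [tsum_eq_zero_add' ENNReal.summable]
  congr 1
  · simp [loopPaths]
  · simp only [loopPaths, Finset.sum_mul]
    rw [Summable.tsum_finsetSum fun _ _ => ENNReal.summable]
    refine Finset.sum_congr rfl fun p _ => ?_
    split_ifs <;> rfl

lemma piW_mul_loopGreen {d m : ℕ} (hd : 0 < d) {y : Fin d → ℤ} (hy : memU m y)
    (hfin : loopGreen d m y ≠ ∞) :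
    piW (cU d m) y * loopGreen d m y =
      (if 0 = y then 1 else 0) + ∑' z, loopGreen d m z * cU d m z y := by
  have h := two_mul_loopGreen (m := m) hd y
  rw [← piW_mul_add hy, tsum_mul_cU _ hy] at *
  have hs : ∑ p, (if memU m (latNbr y p) then loopGreen d m (latNbr y p) else loopGreen d m y) =
      ∑ p, (if memU m (latNbr y p) then loopGreen d m (latNbr y p) else 0) +
        ∑ p, (if memU m (latNbr y p) then 0 else loopGreen d m y) := by
    rw [← Finset.sum_add_distrib]
    refine Finset.sum_congr rfl fun p _ => ?_
    split_ifs <;> simp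
  rw [hs, ← add_assoc] at h
  refine (ENNReal.add_left_inj ?_).1 h
  refine ENNReal.sum_ne_top.2 fun p _ => ?_
  split_ifs <;> simp [hfin]

lemma sum_stepN_succ {d m : ℕ} (n : ℕ) (y : Fin d → ℤ) :
    ∑ k ∈ Finset.range (n + 1), stepN (cU d m) k 0 y = (if 0 = y then 1 else 0) +
      ∑' z, (∑ k ∈ Finset.range n, stepN (cU d m) k 0 z) * step (cU d m) z y := by
  rw [Finset.sum_range_succ', add_comm]
  simp_rw [Finset.sum_mul]
  rw [Summable.tsum_finsetSum fun _ _ => ENNReal.summable]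
  rfl

lemma sum_stepN_le {d m : ℕ} (hd : 0 < d) (hfin : ∀ y, memU m y → loopGreen d m y ≠ ∞) (n : ℕ) :
    ∀ y, memU m y →
      ∑ k ∈ Finset.range n, stepN (cU d m) k 0 y ≤ piW (cU d m) y * loopGreen d m y := by
  induction n with
  | zero => simp
  | succ n ih =>
    intro y hy
    rw [sum_stepN_succ, piW_mul_loopGreen hd hy (hfin y hy)]
    gcongr 1
    refine ENNReal.tsum_le_tsum fun z => ?_
    by_cases hz : memU m z
    · calc _ ≤ (piW (cU d m) z * loopGreen d m z) * step (cU d m) z y := by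
            gcongr
            exact ih z hz
        _ = loopGreen d m z * (piW (cU d m) z * (cU d m z y / piW (cU d m) z)) := by
            rw [step]; ring
        _ ≤ _ := by
            gcongr
            exact ENNReal.mul_div_le
    · simp [step, cU, hz]

lemma piW_mul_Gm {d m : ℕ} (hd : 0 < d) {y : Fin d → ℤ} (hy : memU m y) :
    piW (cU d m) y * Gm d m 0 y = (if 0 = y then 1 else 0) + ∑' z, Gm d m 0 z * cU d m z y := by
  rw [Gm, green, ← mul_assoc, ENNReal.mul_inv_cancel (piW_cU_ne_zero hd hy) (piW_cU_ne_top hy),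
    one_mul, tsum_eq_zero_add' ENNReal.summable]
  congr 1
  simp only [stepN]
  rw [ENNReal.tsum_comm]
  refine tsum_congr fun z => ?_
  rw [ENNReal.tsum_mul_right, green, step, div_eq_mul_inv]
  ring

lemma sum_loopPaths_le {d m : ℕ} (hd : 0 < d) (n : ℕ) : ∀ y, memU m y →
    ∑ k ∈ Finset.range n, loopPaths d m k y * (2 * d : ℝ≥0∞)⁻¹ ^ (k + 1) ≤ Gm d m 0 y := by
  have h0 : (2 * d : ℝ≥0∞) ≠ 0 := by simp [hd.ne']
  have ht : (2 * d : ℝ≥0∞) ≠ ∞ := by finiteness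
  induction n with
  | zero => simp
  | succ n ih =>
    intro y hy
    rw [← ENNReal.mul_le_mul_iff_right h0 ht, Finset.mul_sum]
    simp_rw [two_mul_mul_inv_pow hd]
    rw [Finset.sum_range_succ', ← piW_mul_add hy, piW_mul_Gm hd hy, tsum_mul_cU _ hy, add_comm,
      add_assoc, ← Finset.sum_add_distrib]
    gcongr 1
    · simp [loopPaths]
    · simp only [loopPaths, Finset.sum_mul]
      rw [Finset.sum_comm]
      gcongr with p
      split_ifs with hp
      · simpa using ih _ hp
      · simpa using ih _ hy

lemma Gm_eq_loopGreen {d m : ℕ} (hd : 0 < d) (hfin : ∀ y, memU m y → loopGreen d m y ≠ ∞)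
    {y : Fin d → ℤ} (hy : memU m y) : Gm d m 0 y = loopGreen d m y := by
  apply le_antisymm
  · rw [Gm, green, mul_comm, ← div_eq_mul_inv]
    refine ENNReal.div_le_of_le_mul' ?_
    exact ENNReal.tsum_le_of_sum_range_le fun n => sum_stepN_le hd hfin n y hy
  · exact ENNReal.tsum_le_of_sum_range_le fun n => sum_loopPaths_le hd n y hy

open MeasureTheory

/-- The generalized eigenfunctions, of eigenvalue `2 cos θ`, of the adjacency operator on `ℤ`
(`r = false`) and of the one on `ℕ₀` with a loop at the origin (`r = true`). -/
def mode (r : Bool) (k : ℤ) (θ : ℝ) : ℝ :=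
  Real.cos (k * θ) + if r then Real.cos ((k + 1) * θ) else 0

lemma mode_succ_add_mode_pred (r : Bool) (k : ℤ) (θ : ℝ) :
    mode r (k + 1) θ + mode r (k - 1) θ = 2 * Real.cos θ * mode r k θ := by
  have h : ∀ x : ℝ, Real.cos ((x + 1) * θ) + Real.cos ((x - 1) * θ) =
      2 * Real.cos θ * Real.cos (x * θ) := by
    intro x
    rw [add_mul, sub_mul, one_mul, Real.cos_add, Real.cos_sub]
    ring
  have h1 := h k
  have h2 := h (k + 1)
  cases r
  · simpa [mode] using h1
  · simp only [mode, if_true]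
    push_cast
    rw [sub_add_eq_add_sub]
    linarith

lemma mode_true_neg_one (θ : ℝ) : mode true (-1) θ = mode true 0 θ := by
  simp [mode, add_comm]

lemma abs_mode_le (r : Bool) (k : ℤ) (θ : ℝ) : |mode r k θ| ≤ 2 := by
  have h1 := Real.abs_cos_le_one (k * θ)
  have h2 := Real.abs_cos_le_one ((k + 1) * θ)
  rw [abs_le] at *
  cases r <;> simp [mode] <;> constructor <;> linarith

@[fun_prop]
lemma continuous_mode (r : Bool) (k : ℤ) : Continuous (mode r k) := by
  unfold mode
  cases r <;> simp <;> fun_prop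

/-- The uniform probability measure on `(0, π]`. -/
def angleMeasure : Measure ℝ := ENNReal.ofReal (1 / Real.pi) • volume.restrict (Set.Ioc 0 Real.pi)

instance : IsFiniteMeasure angleMeasure := by
  unfold angleMeasure
  exact Measure.smul_finite _ ENNReal.ofReal_ne_top

lemma integral_angleMeasure (f : ℝ → ℝ) :
    ∫ θ, f θ ∂angleMeasure = 1 / Real.pi * ∫ θ in (0 : ℝ)..Real.pi, f θ := by
  rw [angleMeasure, integral_smul_measure, intervalIntegral.integral_of_le Real.pi_pos.le,
    ENNReal.toReal_ofReal (by positivity), smul_eq_mul]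

lemma integrable_angleMeasure {f : ℝ → ℝ} (hf : Continuous f) : Integrable f angleMeasure := by
  refine Integrable.smul_measure ?_ ENNReal.ofReal_ne_top
  exact (hf.integrableOn_Icc (a := 0) (b := Real.pi)).mono_set Set.Ioc_subset_Icc_self

lemma integral_cos_int_mul (k : ℤ) :
    ∫ θ, Real.cos (k * θ) ∂angleMeasure = if k = 0 then 1 else 0 := by
  rw [integral_angleMeasure]
  split_ifs with hk
  · simp [hk, Real.pi_ne_zero]
  · have hk' : (k : ℝ) ≠ 0 := by exact_mod_cast hk
    rw [intervalIntegral.integral_comp_mul_left (fun x => Real.cos x) hk']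
    simp [Real.sin_int_mul_pi]

lemma integral_mode (r : Bool) (k : ℤ) (hk : r = true → 0 ≤ k) :
    ∫ θ, mode r k θ ∂angleMeasure = if k = 0 then 1 else 0 := by
  unfold mode
  cases r
  · simpa using integral_cos_int_mul k
  · have h1 := integral_cos_int_mul k
    have h2 := integral_cos_int_mul (k + 1)
    have hk1 : k + 1 ≠ 0 := by have := hk rfl; omega
    push_cast at h2
    simp only [if_true]
    rw [integral_add (integrable_angleMeasure (by fun_prop))
      (integrable_angleMeasure (by fun_prop)), h1, h2]
    simp [hk1]

/-- Product of the modes over all coordinates, the first `m` ones being reflected. -/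
def prodMode {d : ℕ} (m : ℕ) (y : Fin d → ℤ) (θ : Fin d → ℝ) : ℝ :=
  ∏ i : Fin d, mode (decide ((i : ℕ) < m)) (y i) (θ i)

/-- The eigenvalue `∑ 2 cos θ_i` of the adjacency operator of `ℤ^d`. -/
def latSymbol {d : ℕ} (θ : Fin d → ℝ) : ℝ := ∑ i, 2 * Real.cos (θ i)

@[fun_prop]
lemma continuous_prodMode {d : ℕ} (m : ℕ) (y : Fin d → ℤ) : Continuous (prodMode m y) := by
  unfold prodMode
  fun_prop

@[fun_prop]
lemma continuous_latSymbol {d : ℕ} : Continuous (latSymbol (d := d)) := by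
  unfold latSymbol
  fun_prop

lemma abs_prodMode_le {d : ℕ} (m : ℕ) (y : Fin d → ℤ) (θ : Fin d → ℝ) :
    |prodMode m y θ| ≤ 2 ^ d := by
  rw [prodMode, Finset.abs_prod]
  calc _ ≤ ∏ _i : Fin d, (2 : ℝ) :=
        Finset.prod_le_prod (fun _ _ => abs_nonneg _) fun _ _ => abs_mode_le _ _ _
    _ = _ := by simp

lemma abs_latSymbol_le {d : ℕ} (θ : Fin d → ℝ) : |latSymbol θ| ≤ 2 * d := by
  calc _ ≤ ∑ i, |2 * Real.cos (θ i)| := Finset.abs_sum_le_sum_abs _ _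
    _ ≤ ∑ _i : Fin d, (2 : ℝ) := by
        gcongr with i
        rw [abs_mul, abs_two]
        linarith [Real.abs_cos_le_one (θ i)]
    _ = _ := by simp [mul_comm]

lemma prodMode_latNbr {d : ℕ} (m : ℕ) (y : Fin d → ℤ) (p : Fin d × Bool) (θ : Fin d → ℝ) :
    prodMode m (latNbr y p) θ =
      mode (decide ((p.1 : ℕ) < m)) (y p.1 + if p.2 then 1 else -1) (θ p.1) *
        ∏ j ∈ Finset.univ \ {p.1}, mode (decide ((j : ℕ) < m)) (y j) (θ j) := by
  rw [prodMode, ← Finset.prod_update_of_mem (Finset.mem_univ p.1)]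
  refine Finset.prod_congr rfl fun j _ => ?_
  exact Function.apply_update (fun (i : Fin d) k => mode (decide ((i : ℕ) < m)) k (θ i)) y _ _ j

lemma prodMode_eq_mul {d : ℕ} (m : ℕ) (y : Fin d → ℤ) (i : Fin d) (θ : Fin d → ℝ) :
    prodMode m y θ = mode (decide ((i : ℕ) < m)) (y i) (θ i) *
        ∏ j ∈ Finset.univ \ {i}, mode (decide ((j : ℕ) < m)) (y j) (θ j) := by
  rw [prodMode, ← Finset.prod_update_of_mem (Finset.mem_univ i)]
  simp [Function.update_eq_self]

lemma sum_prodMode_latNbr {d : ℕ} (m : ℕ) (y : Fin d → ℤ) (θ : Fin d → ℝ) :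
    ∑ p, prodMode m (latNbr y p) θ = latSymbol θ * prodMode m y θ := by
  rw [Fintype.sum_prod_type, latSymbol, Finset.sum_mul]
  refine Finset.sum_congr rfl fun i _ => ?_
  rw [Fintype.sum_bool, prodMode_latNbr, prodMode_latNbr, prodMode_eq_mul m y i, ← mul_assoc,
    ← mode_succ_add_mode_pred]
  simp only [if_true, Bool.false_eq_true, if_false]
  ring_nf

lemma prodMode_latNbr_of_not_memU {d m : ℕ} {y : Fin d → ℤ} (hy : memU m y) {p : Fin d × Bool}
    (hp : ¬ memU m (latNbr y p)) (θ : Fin d → ℝ) :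
    prodMode m (latNbr y p) θ = prodMode m y θ := by
  unfold memU at hp
  push Not at hp
  obtain ⟨j, hj, hneg⟩ := hp
  have hyj := hy j hj
  obtain ⟨i, b⟩ := p
  have hij : j = i := by
    by_contra hne
    simp [latNbr, hne] at hneg
    omega
  subst hij
  simp only [latNbr, Function.update_self] at hneg
  have hb : b = false := by
    by_contra hb
    simp at hb
    simp [hb] at hneg
    omega
  subst hb
  have hy0 : y j = 0 := by simp at hneg; omega
  rw [prodMode_latNbr, prodMode_eq_mul m y j]
  simp [hy0, hj, mode_true_neg_one]

/-- The measure on `ℝ^d` whose marginals are uniform on `(0, π]`. -/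
def anglesMeasure (d : ℕ) : Measure (Fin d → ℝ) := Measure.pi fun _ => angleMeasure

instance (d : ℕ) : IsFiniteMeasure (anglesMeasure d) := by
  unfold anglesMeasure
  infer_instance

/-- Spectral formula for the number of `n`-step paths from `0` to `y`. -/
def modeIntegral (d m n : ℕ) (y : Fin d → ℤ) : ℝ :=
  ∫ θ, latSymbol θ ^ n * prodMode m y θ ∂anglesMeasure d

lemma integrable_latSymbol_pow_mul_prodMode (d m n : ℕ) (y : Fin d → ℤ) :
    Integrable (fun θ => latSymbol θ ^ n * prodMode m y θ) (anglesMeasure d) := by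
  refine Integrable.of_bound (C := (2 * d) ^ n * 2 ^ d)
    (by fun_prop : Continuous _).aestronglyMeasurable (ae_of_all _ fun θ => ?_)
  rw [Real.norm_eq_abs, abs_mul, abs_pow]
  gcongr
  · exact abs_latSymbol_le θ
  · exact abs_prodMode_le m y θ

lemma modeIntegral_zero {d m : ℕ} {y : Fin d → ℤ} (hy : memU m y) :
    modeIntegral d m 0 y = if 0 = y then 1 else 0 := by
  simp only [modeIntegral, pow_zero, one_mul, prodMode, anglesMeasure]
  rw [integral_fintype_prod_eq_prod (𝕜 := ℝ)
    (fun (i : Fin d) => mode (decide ((i : ℕ) < m)) (y i))]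
  rw [Finset.prod_congr rfl fun i _ => integral_mode _ (y i) fun h => hy i (by simpa using h)]
  split_ifs with h
  · simp [← h]
  · obtain ⟨i, hi⟩ := Function.ne_iff.1 h
    exact Finset.prod_eq_zero (Finset.mem_univ i) (if_neg fun h0 => hi h0.symm)

lemma modeIntegral_succ {d m : ℕ} (n : ℕ) {y : Fin d → ℤ} (hy : memU m y) :
    modeIntegral d m (n + 1) y = ∑ p, if memU m (latNbr y p) then modeIntegral d m n (latNbr y p)
      else modeIntegral d m n y := by
  have h : ∀ p, (if memU m (latNbr y p) then modeIntegral d m n (latNbr y p)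
      else modeIntegral d m n y) = modeIntegral d m n (latNbr y p) := by
    intro p
    split_ifs with hp
    · rfl
    · simp only [modeIntegral, prodMode_latNbr_of_not_memU hy hp]
  rw [Finset.sum_congr rfl fun p _ => h p]
  simp only [modeIntegral]
  rw [← integral_finsetSum _ fun p _ => integrable_latSymbol_pow_mul_prodMode d m n _]
  refine integral_congr_ae (ae_of_all _ fun θ => ?_)
  simp only
  rw [← Finset.mul_sum, sum_prodMode_latNbr]
  ring

lemma modeIntegral_nonneg {d m : ℕ} (n : ℕ) :
    ∀ y : Fin d → ℤ, memU m y → 0 ≤ modeIntegral d m n y := by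
  induction n with
  | zero =>
    intro y hy
    rw [modeIntegral_zero hy]
    split_ifs <;> simp
  | succ n ih =>
    intro y hy
    rw [modeIntegral_succ n hy]
    refine Finset.sum_nonneg fun p _ => ?_
    split_ifs with hp
    · exact ih _ hp
    · exact ih _ hy

lemma loopPaths_eq {d m : ℕ} (n : ℕ) :
    ∀ y : Fin d → ℤ, memU m y → loopPaths d m n y = ENNReal.ofReal (modeIntegral d m n y) := by
  induction n with
  | zero =>
    intro y hy
    rw [modeIntegral_zero hy, loopPaths]
    split_ifs <;> simp
  | succ n ih =>
    intro y hy
    rw [modeIntegral_succ n hy, loopPaths, ENNReal.ofReal_sum_of_nonneg]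
    · refine Finset.sum_congr rfl fun p _ => ?_
      split_ifs with hp
      · exact ih _ hp
      · exact ih _ hy
    · intro p _
      split_ifs with hp
      · exact modeIntegral_nonneg n _ hp
      · exact modeIntegral_nonneg n _ hy

/-- The heat kernel `∑ sⁿ / n! · #{n-step paths 0 → k}` at time `s / 2` in dimension one. -/
def heat (r : Bool) (k : ℤ) (s : ℝ) : ℝ :=
  ∫ θ, Real.exp (s * Real.cos θ) * mode r k θ ∂angleMeasure

lemma heat_false_zero (s : ℝ) : heat false 0 s = besselI 0 s := by
  rw [heat, integral_angleMeasure, besselI]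
  simp [mode]

lemma heat_true_zero (s : ℝ) : heat true 0 s = besselI 1 s + besselI 0 s := by
  have h : ∀ k : ℕ, besselI k s =
      ∫ θ, Real.exp (s * Real.cos θ) * Real.cos (k * θ) ∂angleMeasure := fun k => by
    rw [integral_angleMeasure, besselI]
  rw [h, h, ← integral_add (integrable_angleMeasure (by fun_prop))
    (integrable_angleMeasure (by fun_prop)), heat]
  refine integral_congr_ae (ae_of_all _ fun θ => ?_)
  simp [mode]
  ring

/-- The heat kernel at time `s / 2` from `0` to `y`. -/
def prodHeat {d : ℕ} (m : ℕ) (y : Fin d → ℤ) (s : ℝ) : ℝ :=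
  ∏ i : Fin d, heat (decide ((i : ℕ) < m)) (y i) s

lemma prodHeat_zero {d m : ℕ} (hm : m ≤ d) (s : ℝ) : prodHeat m (0 : Fin d → ℤ) s =
    (besselI 1 s + besselI 0 s) ^ m * besselI 0 s ^ (d - m) := by
  obtain ⟨e, rfl⟩ := Nat.exists_eq_add_of_le hm
  simp [prodHeat, Fin.prod_univ_add, heat_true_zero, heat_false_zero]

lemma hasSum_exp_div (x : ℝ) : HasSum (fun n : ℕ => x ^ n / n.factorial) (Real.exp x) := by
  rw [Real.exp_eq_exp_ℝ]
  exact NormedSpace.expSeries_div_hasSum_exp x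

lemma hasSum_modeIntegral {d : ℕ} (m : ℕ) (y : Fin d → ℤ) (s : ℝ) :
    HasSum (fun n : ℕ => s ^ n / n.factorial * modeIntegral d m n y) (prodHeat m y (2 * s)) := by
  have hprod : prodHeat m y (2 * s) =
      ∫ θ, Real.exp (s * latSymbol θ) * prodMode m y θ ∂anglesMeasure d := by
    simp only [prodHeat, heat, anglesMeasure]
    rw [← integral_fintype_prod_eq_prod (𝕜 := ℝ) (fun (i : Fin d) θ =>
      Real.exp (2 * s * Real.cos θ) * mode (decide ((i : ℕ) < m)) (y i) θ)]
    refine integral_congr_ae (ae_of_all _ fun θ => ?_)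
    simp only [Finset.prod_mul_distrib, prodMode, latSymbol, Finset.mul_sum, Real.exp_sum]
    congr 1
    refine Finset.prod_congr rfl fun i _ => ?_
    ring_nf
  rw [hprod]
  simp_rw [modeIntegral, ← integral_const_mul]
  refine hasSum_integral_of_dominated_convergence
    (fun n _ => (|s| * (2 * d)) ^ n / n.factorial * 2 ^ d) ?_ ?_ ?_ ?_ ?_
  · intro n
    exact (by fun_prop : Continuous _).aestronglyMeasurable
  · refine fun n => ae_of_all _ fun θ => ?_
    rw [Real.norm_eq_abs, abs_mul, abs_mul, abs_div, abs_pow, abs_pow, Nat.abs_cast, mul_pow,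
      mul_div_right_comm, mul_assoc]
    gcongr
    · exact abs_latSymbol_le θ
    · exact abs_prodMode_le m y θ
  · exact ae_of_all _ fun _ => ((hasSum_exp_div _).summable).mul_right _
  · exact integrable_const _
  · refine ae_of_all _ fun θ => ?_
    convert! (hasSum_exp_div (s * latSymbol θ)).mul_right (prodMode m y θ) using 2 with n
    rw [mul_pow]
    ring

lemma abs_heat_le (r : Bool) (k : ℤ) (s : ℝ) :
    |heat r k s| ≤ 2 * ∫ θ, Real.exp (s * Real.cos θ) ∂angleMeasure := by
  rw [heat, ← Real.norm_eq_abs, ← integral_const_mul]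
  refine norm_integral_le_of_norm_le (integrable_angleMeasure (by fun_prop))
    (ae_of_all _ fun θ => ?_)
  rw [Real.norm_eq_abs, abs_mul, Real.abs_exp, mul_comm]
  gcongr
  exact abs_mode_le r k θ

lemma abs_heat_le_exp (r : Bool) (k : ℤ) {s : ℝ} (hs : 0 ≤ s) :
    |heat r k s| ≤ 2 * Real.exp s := by
  refine (abs_heat_le r k s).trans ?_
  gcongr
  have h1 : ∫ _θ, Real.exp s ∂angleMeasure = Real.exp s := by
    rw [integral_angleMeasure]
    simp [Real.pi_ne_zero]
  calc _ ≤ ∫ _θ, Real.exp s ∂angleMeasure := by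
        refine integral_mono (integrable_angleMeasure (by fun_prop)) (integrable_const _)
          fun θ => ?_
        simp only
        gcongr
        exact mul_le_of_le_one_right hs (Real.cos_le_one θ)
    _ = _ := h1

lemma exists_abs_heat_le_rpow : ∃ C : ℝ, 0 ≤ C ∧ ∀ (r : Bool) (k : ℤ) (s : ℝ), 0 < s →
    |heat r k s| ≤ C * s ^ (-(1 / 2) : ℝ) * Real.exp s := by
  refine ⟨2 * (1 / Real.pi * (√(Real.pi / (2 / Real.pi ^ 2)) / 2)), by positivity,
    fun r k s hs => ?_⟩
  refine (abs_heat_le r k s).trans ?_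
  rw [integral_angleMeasure, mul_assoc, mul_assoc, mul_assoc]
  gcongr
  have hb : 0 < 2 / Real.pi ^ 2 * s := by positivity
  have hint : Integrable fun x : ℝ => Real.exp (-(2 / Real.pi ^ 2 * s) * x ^ 2) :=
    integrable_exp_neg_mul_sq hb
  have hsqrt : √(Real.pi / (2 / Real.pi ^ 2 * s)) =
      √(Real.pi / (2 / Real.pi ^ 2)) * s ^ (-(1 / 2) : ℝ) := by
    rw [Real.rpow_neg hs.le, ← Real.sqrt_eq_rpow, ← div_div, Real.sqrt_div (by positivity),
      div_eq_mul_inv]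
  calc ∫ θ in (0 : ℝ)..Real.pi, Real.exp (s * Real.cos θ)
      ≤ ∫ θ in Set.Ioc 0 Real.pi, Real.exp s * Real.exp (-(2 / Real.pi ^ 2 * s) * θ ^ 2) := by
        rw [intervalIntegral.integral_of_le Real.pi_pos.le]
        refine setIntegral_mono_on
          ((by fun_prop : Continuous _).integrableOn_Icc.mono_set Set.Ioc_subset_Icc_self)
          (hint.const_mul _).integrableOn measurableSet_Ioc fun θ hθ => ?_
        rw [← Real.exp_add]
        gcongr
        have := Real.cos_le_one_sub_mul_cos_sq (abs_le.2 ⟨by linarith [hθ.1, Real.pi_pos], hθ.2⟩)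
        nlinarith
    _ ≤ ∫ θ in Set.Ioi 0, Real.exp s * Real.exp (-(2 / Real.pi ^ 2 * s) * θ ^ 2) := by
        refine setIntegral_mono_set (hint.const_mul _).integrableOn
          (ae_of_all _ fun θ => by simp only [Pi.zero_apply]; positivity)
          (Set.Ioc_subset_Ioi_self.eventuallyLE)
    _ = _ := by
        rw [integral_const_mul, integral_gaussian_Ioi, hsqrt]
        ring

lemma measurable_heat (r : Bool) (k : ℤ) : Measurable (heat r k) := by
  have h : Continuous (Function.uncurry fun s θ : ℝ => Real.exp (s * Real.cos θ) * mode r k θ) := by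
    fun_prop
  exact (h.stronglyMeasurable.integral_prod_right (ν := angleMeasure)).measurable

lemma abs_exp_neg_mul_prodHeat_le {d : ℕ} (hd : 0 < d) (m : ℕ) (y : Fin d → ℤ) {x b : ℝ}
    (h : ∀ r k, |heat r k (x / d)| ≤ b * Real.exp (x / d)) :
    |Real.exp (-x) * prodHeat m y (x / d)| ≤ b ^ d := by
  have hd' : (d : ℝ) ≠ 0 := by exact_mod_cast hd.ne'
  rw [abs_mul, Real.abs_exp, prodHeat, Finset.abs_prod]
  calc _ ≤ Real.exp (-x) * ∏ _i : Fin d, (b * Real.exp (x / d)) := by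
        gcongr with i
        exact h _ _
    _ = b ^ d := by
        rw [Finset.prod_const, Finset.card_univ, Fintype.card_fin, mul_pow, ← Real.exp_nat_mul,
          mul_div_cancel₀ _ hd', mul_left_comm, ← Real.exp_add]
        simp

lemma integrableOn_exp_neg_mul_prodHeat {d : ℕ} (hd : 3 ≤ d) (m : ℕ) (y : Fin d → ℤ) :
    IntegrableOn (fun x => Real.exp (-x) * prodHeat m y (x / d)) (Set.Ioi 0) := by
  have hd0 : 0 < d := by omega
  have hdR : (0 : ℝ) < d := by exact_mod_cast hd0
  have hmeas : Measurable fun x : ℝ => Real.exp (-x) * prodHeat m y (x / d) := by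
    unfold prodHeat
    refine (by fun_prop : Measurable fun x : ℝ => Real.exp (-x)).mul
      (Finset.measurable_prod _ fun i _ => ?_)
    exact (measurable_heat _ _).comp (by fun_prop)
  obtain ⟨C, hC, hheat⟩ := exists_abs_heat_le_rpow
  rw [← Set.Ioc_union_Ioi_eq_Ioi (zero_le_one' ℝ)]
  refine IntegrableOn.union ?_ ?_
  · refine Integrable.mono' (g := fun _ => 2 ^ d) (integrable_const _)
      hmeas.aestronglyMeasurable ?_
    refine (ae_restrict_iff' measurableSet_Ioc).2 (ae_of_all _ fun x hx => ?_)
    exact abs_exp_neg_mul_prodHeat_le hd0 m y fun r k =>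
      abs_heat_le_exp r k (div_nonneg hx.1.le hdR.le)
  · have hexp : -(d / 2 : ℝ) < -1 := by
      have : (3 : ℝ) ≤ d := by exact_mod_cast hd
      linarith
    refine Integrable.mono'
      (g := fun x => (C / (d : ℝ) ^ (-(1 / 2) : ℝ)) ^ d * x ^ (-(d / 2) : ℝ))
      ((integrableOn_Ioi_rpow_of_lt hexp zero_lt_one).const_mul _)
      hmeas.aestronglyMeasurable ?_
    refine (ae_restrict_iff' measurableSet_Ioi).2 (ae_of_all _ fun x hx => ?_)
    have hx0 : 0 < x := zero_lt_one.trans hx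
    refine (abs_exp_neg_mul_prodHeat_le hd0 m y fun r k =>
      hheat r k (x / d) (div_pos hx0 hdR)).trans_eq ?_
    have hpow : x ^ (-(d / 2) : ℝ) = (x ^ (-(1 / 2) : ℝ)) ^ d := by
      rw [← Real.rpow_mul_natCast hx0.le]
      congr 1
      ring
    rw [hpow, ← mul_pow, Real.div_rpow hx0.le hdR.le]
    ring

lemma integrableOn_exp_neg_mul_pow (n : ℕ) :
    IntegrableOn (fun x : ℝ => Real.exp (-x) * x ^ n) (Set.Ioi 0) := by
  simpa using Real.GammaIntegral_convergent (s := n + 1) (by positivity)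

lemma integral_exp_neg_mul_pow (n : ℕ) :
    ∫ x in Set.Ioi (0 : ℝ), Real.exp (-x) * x ^ n = n.factorial := by
  rw [← Real.Gamma_nat_eq_factorial, Real.Gamma_eq_integral (by positivity)]
  simp

lemma lintegral_poisson_modeIntegral {d m : ℕ} (hd : 0 < d) (n : ℕ) {y : Fin d → ℤ}
    (hy : memU m y) :
    ∫⁻ x in Set.Ioi (0 : ℝ), ENNReal.ofReal (1 / (2 * d) *
      (Real.exp (-x) * ((x / (2 * d)) ^ n / n.factorial * modeIntegral d m n y))) =
      loopPaths d m n y * (2 * d : ℝ≥0∞)⁻¹ ^ (n + 1) := by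
  have hdR : (0 : ℝ) < d := by exact_mod_cast hd
  have ha := modeIntegral_nonneg n y hy
  have hf : ∀ x : ℝ, 1 / (2 * d) *
      (Real.exp (-x) * ((x / (2 * d)) ^ n / n.factorial * modeIntegral d m n y)) =
      modeIntegral d m n y * (2 * d : ℝ)⁻¹ ^ (n + 1) / n.factorial * (Real.exp (-x) * x ^ n) := by
    intro x
    rw [div_pow, inv_pow, pow_succ]
    field_simp
  simp_rw [hf]
  rw [← ofReal_integral_eq_lintegral_ofReal, integral_const_mul, integral_exp_neg_mul_pow,
    div_mul_cancel₀ _ (by positivity), ENNReal.ofReal_mul ha, ENNReal.ofReal_pow (by positivity),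
    ENNReal.ofReal_inv_of_pos (by positivity), loopPaths_eq n y hy]
  · congr 3
    rw [ENNReal.ofReal_mul (by norm_num)]
    simp
  · exact (integrableOn_exp_neg_mul_pow n).const_mul _
  · refine (ae_restrict_iff' measurableSet_Ioi).2 (ae_of_all _ fun x hx => ?_)
    have hx0 : (0 : ℝ) < x := hx
    simp only [Pi.zero_apply]
    positivity

lemma loopGreen_eq_lintegral {d m : ℕ} (hd : 0 < d) {y : Fin d → ℤ} (hy : memU m y) :
    loopGreen d m y = ∫⁻ x in Set.Ioi (0 : ℝ),
      ENNReal.ofReal (1 / (2 * d) * (Real.exp (-x) * prodHeat m y (x / d))) := by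
  have hdR : (0 : ℝ) < d := by exact_mod_cast hd
  simp_rw [loopGreen, ← lintegral_poisson_modeIntegral hd _ hy]
  rw [← lintegral_tsum fun n => by fun_prop]
  refine setLIntegral_congr_fun measurableSet_Ioi fun x hx => ?_
  have hx0 : (0 : ℝ) < x := hx
  have hs := ((hasSum_modeIntegral m y (x / (2 * d))).mul_left (Real.exp (-x))).mul_left
    (1 / (2 * d : ℝ))
  have h2 : 2 * (x / (2 * d)) = x / d := by field_simp
  rw [h2] at hs
  rw [← ENNReal.ofReal_tsum_of_nonneg (fun n => ?_) hs.summable, hs.tsum_eq]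
  have ha := modeIntegral_nonneg n y hy
  positivity

lemma exp_neg_mul_prodHeat_nonneg {d m : ℕ} {y : Fin d → ℤ} (hy : memU m y) {x : ℝ} (hx : 0 ≤ x) :
    0 ≤ Real.exp (-x) * prodHeat m y (x / d) := by
  have h := hasSum_modeIntegral m y (x / d / 2)
  rw [mul_div_cancel₀ _ two_ne_zero] at h
  refine mul_nonneg (Real.exp_pos _).le (h.nonneg fun n => ?_)
  have ha := modeIntegral_nonneg n y hy
  positivity

lemma loopGreen_eq_ofReal {d m : ℕ} (hd : 3 ≤ d) {y : Fin d → ℤ} (hy : memU m y) :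
    loopGreen d m y = ENNReal.ofReal (1 / (2 * d) *
      ∫ x in Set.Ioi (0 : ℝ), Real.exp (-x) * prodHeat m y (x / d)) := by
  rw [loopGreen_eq_lintegral (by omega) hy, ← integral_const_mul,
    ofReal_integral_eq_lintegral_ofReal]
  · exact (integrableOn_exp_neg_mul_prodHeat hd m y).const_mul _
  · refine (ae_restrict_iff' measurableSet_Ioi).2 (ae_of_all _ fun x hx => ?_)
    exact mul_nonneg (by positivity) (exp_neg_mul_prodHeat_nonneg hy (le_of_lt hx))

/-- For `d ≥ 3` and `0 ≤ m ≤ d`, the Green's function of `U_m = ℕ₀^m × ℤ^{d-m}` at the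
origin is `G_m(0,0) = (1/(2d)) ∫_0^∞ e^{-x} (I₁(x/d) + I₀(x/d))^m I₀(x/d)^{d-m} dx`. -/
theorem green_Um_origin_integral (d : ℕ) (hd : 3 ≤ d) (m : ℕ) (hm : m ≤ d) :
    Gm d m 0 0 = ENNReal.ofReal ((1 / (2 * (d : ℝ))) *
      ∫ x in Set.Ioi (0 : ℝ), Real.exp (-x) *
        ((besselI 1 (x / d) + besselI 0 (x / d)) ^ m * besselI 0 (x / d) ^ (d - m))) := by
  have h0 : memU m (0 : Fin d → ℤ) := fun i _ => le_rfl
  have hfin : ∀ y : Fin d → ℤ, memU m y → loopGreen d m y ≠ ∞ := fun y hy => by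
    rw [loopGreen_eq_ofReal hd hy]
    exact ENNReal.ofReal_ne_top
  rw [Gm_eq_loopGreen (by omega) hfin h0, loopGreen_eq_ofReal hd h0]
  simp_rw [prodHeat_zero hm]

end
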